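/- Let X be a real normed vector space, let 2 ≤ p < ∞, and let Y be a real Banach space that is an L_p-space. Let T : X → Y be a Lipschitz map, let w ∈ X, and define T_w : X → Y by T_w(x) = T(w + x) − T(w). If the restriction of the Lipschitz adjoint of T_w to Y*, namely the linear map Y* → X^# sending y* to y* ∘ T_w, is almost p-summing, then T is Lipschitz 1-summing at the point w; that is, there exists C ≥ 0 such that ∑_{i=1}^n ‖T(w + xᵢ) − T(w + qᵢ)‖ ≤ C · sup_{φ ∈ B_{X^#}} ∑_{i=1}^n |φ(xᵢ) − φ(qᵢ)| for every n and all x₁,…,xₙ,q₁,…,qₙ ∈ X. -/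

import Mathlib

open scoped BigOperators NNReal

/-- The weak `ℓ_p` norm of a finite family in a normed space. -/
noncomputable def weakNorm (p : ℝ) {E : Type*} [NormedAddCommGroup E] [NormedSpace ℝ E]
    {n : ℕ} (x : Fin n → E) : ℝ :=
  ⨆ φ : {φ : E →L[ℝ] ℝ // ‖φ‖ ≤ 1}, (∑ i, |φ.1 (x i)| ^ p) ^ (1 / p)

/-- The Lipschitz norm of `g : X → ℝ`, i.e. the norm in `X^#`. -/
noncomputable def lipNorm {X : Type*} [MetricSpace X] (g : X → ℝ) : ℝ :=
  sInf {K : ℝ | 0 ≤ K ∧ ∀ x y : X, |g x - g y| ≤ K * dist x y}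

/-- A map `u : E → X^#` (into functions `X → ℝ` measured with the Lipschitz norm) is almost
`p`-summing. -/
def AlmostSummingIntoLip (p : ℝ) {E X : Type*} [NormedAddCommGroup E] [NormedSpace ℝ E]
    [MetricSpace X] (u : E → X → ℝ) : Prop :=
  ∃ C : ℝ, 0 ≤ C ∧ ∀ (n : ℕ) (h : Fin n → E),
    Real.sqrt ((2 ^ n : ℝ)⁻¹ * ∑ ε : Fin n → Bool,
        lipNorm (fun x : X => ∑ i, (if ε i then (1 : ℝ) else -1) * u (h i) x) ^ 2) ≤
      C * weakNorm p h

/-- The `ℓ_p` norm on `ℝ^m`. -/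
noncomputable def lpNorm (p : ℝ) {m : ℕ} (y : Fin m → ℝ) : ℝ :=
  (∑ k, |y k| ^ p) ^ (1 / p)

/-- `Y` is an `L_{p,λ}`-space. -/
def IsLpSpaceWith (p lam : ℝ) (Y : Type*) [NormedAddCommGroup Y] [NormedSpace ℝ Y] : Prop :=
  ∀ E : Submodule ℝ Y, FiniteDimensional ℝ E →
    ∃ Y₀ : Submodule ℝ Y, E ≤ Y₀ ∧ FiniteDimensional ℝ Y₀ ∧
      ∃ v : Y₀ ≃ₗ[ℝ] (Fin (Module.finrank ℝ Y₀) → ℝ), ∃ a b : ℝ,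
        (∀ y : Y₀, lpNorm p (v y) ≤ a * ‖y‖) ∧
        (∀ z : Fin (Module.finrank ℝ Y₀) → ℝ, ‖v.symm z‖ ≤ b * lpNorm p z) ∧
        a * b ≤ lam

section Rademacher

/-- The Rademacher sum `∑ εᵢ aᵢ`, with signs encoded by booleans. -/
noncomputable def rademacherSum {n : ℕ} (a : Fin n → ℝ) (ε : Fin n → Bool) : ℝ :=
  ∑ i, (if ε i then (1 : ℝ) else -1) * a i

theorem sum_rademacherSum_succ {n : ℕ} (a : Fin (n + 1) → ℝ) (F : ℝ → ℝ) :
    ∑ ε, F (rademacherSum a ε) =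
      ∑ ε, (F (a 0 + rademacherSum (fun i => a i.succ) ε) +
        F (-a 0 + rademacherSum (fun i => a i.succ) ε)) := by
  rw [← Fintype.sum_equiv (Fin.consEquiv fun _ : Fin (n + 1) => Bool)
    (fun x => F (rademacherSum a (Fin.cons x.1 x.2))) _ (fun x => rfl),
    Fintype.sum_prod_type, Fintype.sum_bool, ← Finset.sum_add_distrib]
  simp [rademacherSum, Fin.sum_univ_succ]

theorem sum_rademacherSum_sq {n : ℕ} (a : Fin n → ℝ) :
    ∑ ε, rademacherSum a ε ^ 2 = 2 ^ n * ∑ i, a i ^ 2 := by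
  induction n with
  | zero => simp [rademacherSum]
  | succ n ih =>
    rw [sum_rademacherSum_succ a (· ^ 2), Fin.sum_univ_succ,
      Finset.sum_congr rfl fun ε _ => show _ =
        2 * a 0 ^ 2 + 2 * rademacherSum (fun i => a i.succ) ε ^ 2 by ring,
      Finset.sum_add_distrib]
    simp only [← Finset.mul_sum, ih]
    simp
    ring

theorem sum_rademacherSum_pow_four_le {n : ℕ} (a : Fin n → ℝ) :
    ∑ ε, rademacherSum a ε ^ 4 ≤ 2 ^ n * (3 * (∑ i, a i ^ 2) ^ 2) := by
  induction n with
  | zero => simp [rademacherSum]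
  | succ n ih =>
    have h := ih fun i => a i.succ
    have h₂ := sum_rademacherSum_sq fun i => a i.succ
    rw [sum_rademacherSum_succ a (· ^ 4), Fin.sum_univ_succ,
      Finset.sum_congr rfl fun ε _ => show _ =
        2 * a 0 ^ 4 + (12 * a 0 ^ 2 * rademacherSum (fun i => a i.succ) ε ^ 2 +
          2 * rademacherSum (fun i => a i.succ) ε ^ 4) by ring,
      Finset.sum_add_distrib, Finset.sum_add_distrib]
    simp only [← Finset.mul_sum, h₂, Finset.sum_const, Finset.card_univ, Fintype.card_fun,
      Fintype.card_bool, Fintype.card_fin, nsmul_eq_mul, Nat.cast_pow, Nat.cast_ofNat]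
    have : 0 ≤ (2 : ℝ) ^ n * a 0 ^ 4 := by positivity
    rw [pow_succ (2 : ℝ)]
    nlinarith

/-- The Khinchine inequality in `L₁`. -/
theorem sqrt_sum_sq_le_rademacher {n : ℕ} (a : Fin n → ℝ) :
    √(∑ i, a i ^ 2) ≤ 9 / 5 * ((2 ^ n : ℝ)⁻¹ * ∑ ε, |rademacherSum a ε|) := by
  set s := √(∑ i, a i ^ 2) with hs
  have hsq : s ^ 2 = ∑ i, a i ^ 2 := Real.sq_sqrt (by positivity)
  have hs0 : 0 ≤ s := Real.sqrt_nonneg _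
  rcases hs0.eq_or_lt with h0 | hpos
  · rw [← h0]; positivity
  have key : ∀ t : ℝ, t ^ 2 / s - 4 / 27 * (t ^ 4 / s ^ 3) ≤ |t| := by
    intro t
    have h : |t| - (t ^ 2 / s - 4 / 27 * (t ^ 4 / s ^ 3)) =
        4 / 27 * |t| * (|t| / s - 3 / 2) ^ 2 * (|t| / s + 3) := by
      rw [← sq_abs t, ← Even.pow_abs (by decide : Even 4) t]
      field_simp
      ring
    have : 0 ≤ 4 / 27 * |t| * (|t| / s - 3 / 2) ^ 2 * (|t| / s + 3) := by positivity
    linarith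
  have h := Finset.sum_le_sum fun ε (_ : ε ∈ Finset.univ) => key (rademacherSum a ε)
  rw [Finset.sum_sub_distrib, ← Finset.mul_sum, ← Finset.sum_div, ← Finset.sum_div,
    sum_rademacherSum_sq, ← hsq] at h
  have h4 := sum_rademacherSum_pow_four_le a
  rw [← hsq] at h4
  have h4' : (∑ ε, rademacherSum a ε ^ 4) / s ^ 3 ≤ 2 ^ n * (3 * s) := by
    rw [div_le_iff₀ (by positivity)]
    linarith
  have h2 : 2 ^ n * s ^ 2 / s = 2 ^ n * s := by field_simp
  have h5 : 2 ^ n * s ≤ 9 / 5 * ∑ ε, |rademacherSum a ε| := by linarith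
  have : s = (2 ^ n : ℝ)⁻¹ * (2 ^ n * s) := by field_simp
  rw [this]
  calc _ ≤ (2 ^ n : ℝ)⁻¹ * (9 / 5 * ∑ ε, |rademacherSum a ε|) := by gcongr
    _ = _ := by ring

end Rademacher

section LpNorm

theorem lpNorm_nonneg (p : ℝ) {m : ℕ} (z : Fin m → ℝ) : 0 ≤ lpNorm p z :=
  Real.rpow_nonneg (Finset.sum_nonneg fun _ _ => Real.rpow_nonneg (abs_nonneg _) _) _

theorem lpNorm_rpow {p : ℝ} (hp : 0 < p) {m : ℕ} (z : Fin m → ℝ) :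
    lpNorm p z ^ p = ∑ k, |z k| ^ p := by
  rw [lpNorm, one_div, Real.rpow_inv_rpow (by positivity) hp.ne']

theorem lpNorm_smul {p : ℝ} (hp : 0 < p) {m : ℕ} (c : ℝ) (z : Fin m → ℝ) :
    lpNorm p (c • z) = |c| * lpNorm p z := by
  simp only [lpNorm, Pi.smul_apply, smul_eq_mul, abs_mul]
  rw [Finset.sum_congr rfl fun k _ => Real.mul_rpow (abs_nonneg c) (abs_nonneg (z k)),
    ← Finset.mul_sum, Real.mul_rpow (by positivity) (by positivity), one_div,
    Real.rpow_rpow_inv (abs_nonneg c) hp.ne']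

theorem lpNorm_sum_le {p : ℝ} (hp : 1 ≤ p) {m : ℕ} {ι : Type*} (s : Finset ι)
    (f : ι → Fin m → ℝ) : lpNorm p (∑ j ∈ s, f j) ≤ ∑ j ∈ s, lpNorm p (f j) := by
  refine Finset.le_sum_of_subadditive (lpNorm p) ?_ ?_ s f
  · simpa using (lpNorm_smul (zero_lt_one.trans_le hp) 0 (0 : Fin m → ℝ)).le
  · exact fun x y => Real.Lp_add_le _ x y hp

theorem continuous_lpNorm {p : ℝ} (hp : 0 < p) (m : ℕ) :
    Continuous (lpNorm p : (Fin m → ℝ) → ℝ) := by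
  unfold lpNorm
  refine Continuous.rpow_const ?_ fun _ => Or.inr (by positivity)
  exact continuous_finsetSum _ fun k _ =>
    (continuous_apply k).abs.rpow_const fun _ => Or.inr hp.le

theorem abs_apply_le_lpNorm {p : ℝ} (hp : 0 < p) {m : ℕ} (z : Fin m → ℝ) (k : Fin m) :
    |z k| ≤ lpNorm p z := by
  rw [← Real.rpow_le_rpow_iff (abs_nonneg _) (lpNorm_nonneg p z) hp, lpNorm_rpow hp]
  exact Finset.single_le_sum (f := fun k => |z k| ^ p)
    (fun _ _ => Real.rpow_nonneg (abs_nonneg _) _) (Finset.mem_univ k)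

theorem lpNorm_le_sqrt_sum_sq {p : ℝ} (hp : 2 ≤ p) {m : ℕ} (z : Fin m → ℝ) :
    lpNorm p z ≤ √(∑ k, z k ^ 2) := by
  have hp0 : 0 < p := by linarith
  set s := √(∑ k, z k ^ 2) with hs
  have hs0 : 0 ≤ s := Real.sqrt_nonneg _
  have hsq : s ^ 2 = ∑ i, z i ^ 2 := Real.sq_sqrt (by positivity)
  rw [← Real.rpow_le_rpow_iff (lpNorm_nonneg p z) hs0 hp0, lpNorm_rpow hp0]
  have hsplit : ∀ t : ℝ, 0 ≤ t → t ^ p = t ^ 2 * t ^ (p - 2) := fun t ht => by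
    rw [← Real.rpow_natCast, ← Real.rpow_add_of_nonneg ht (by norm_num) (by linarith)]
    norm_num
  rw [hsplit s hs0, hsq, Finset.sum_mul]
  refine Finset.sum_le_sum fun k _ => ?_
  rw [hsplit _ (abs_nonneg _), sq_abs]
  have hz : |z k| ≤ s := Real.abs_le_sqrt (Finset.single_le_sum (f := fun k => z k ^ 2)
    (fun _ _ => sq_nonneg _) (Finset.mem_univ k))
  exact mul_le_mul_of_nonneg_left
    (Real.rpow_le_rpow (abs_nonneg _) hz (by linarith)) (sq_nonneg _)

end LpNorm

section Discretization

/-- Hölder's inequality with one factor written as a `(p - 1)`-st power. -/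
theorem abs_sum_mul_le_of_abs_eq_rpow {p : ℝ} (hp : 1 < p) {ι : Type*} (A : Finset ι)
    (z u s : ι → ℝ) (hu : ∀ k, |u k| = |s k| ^ (p - 1)) :
    |∑ k ∈ A, z k * u k| ≤
      (∑ k ∈ A, |z k| ^ p) ^ (1 / p) * (∑ k ∈ A, |s k| ^ p) ^ (1 - 1 / p) := by
  have hp1 : p - 1 ≠ 0 := by linarith
  have h := Real.inner_le_Lp_mul_Lq A (fun k => |z k|) (fun k => |u k|)
    (Real.HolderConjugate.conjExponent hp)
  have hq : 1 / p.conjExponent = 1 - 1 / p := by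
    rw [Real.conjExponent]; field_simp
  have hu' : ∀ k, |u k| ^ p.conjExponent = |s k| ^ p := fun k => by
    rw [hu, ← Real.rpow_mul (abs_nonneg _), Real.conjExponent]
    congr 1
    field_simp
  simp only [hq, abs_abs, hu'] at h
  calc _ ≤ ∑ k ∈ A, |z k * u k| := Finset.abs_sum_le_sum_abs _ _
    _ ≤ _ := by simpa only [abs_mul] using h

variable {ι : Type*}

/-- The functional on `ℓ_p` norming the restriction of the nonnegative vector `g` to `A`. -/
noncomputable def blockFunctional (p : ℝ) (A : Finset ι) (g : ι → ℝ) : (ι → ℝ) →ₗ[ℝ] ℝ :=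
  ((∑ k ∈ A, g k ^ p) ^ (1 - 1 / p))⁻¹ • ∑ k ∈ A, g k ^ (p - 1) • LinearMap.proj k

theorem blockFunctional_apply (p : ℝ) (A : Finset ι) (g z : ι → ℝ) :
    blockFunctional p A g z =
      (∑ k ∈ A, z k * g k ^ (p - 1)) / (∑ k ∈ A, g k ^ p) ^ (1 - 1 / p) := by
  simp [blockFunctional, div_eq_inv_mul, mul_comm]

theorem abs_blockFunctional_rpow_le {p : ℝ} (hp : 1 < p) (A : Finset ι) {g : ι → ℝ}
    (hg : ∀ k, 0 ≤ g k) (z : ι → ℝ) :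
    |blockFunctional p A g z| ^ p ≤ ∑ k ∈ A, |z k| ^ p := by
  have hp0 : 0 < p := by linarith
  have hG : 0 ≤ ∑ k ∈ A, g k ^ p :=
    Finset.sum_nonneg fun k _ => Real.rpow_nonneg (hg k) _
  have h := abs_sum_mul_le_of_abs_eq_rpow hp A z (fun k => g k ^ (p - 1)) g fun k => by
    rw [abs_of_nonneg (hg k), abs_of_nonneg (Real.rpow_nonneg (hg k) _)]
  simp only [abs_of_nonneg (hg _)] at h
  have hle : |blockFunctional p A g z| ≤ (∑ k ∈ A, |z k| ^ p) ^ (1 / p) := by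
    rw [blockFunctional_apply, abs_div, abs_of_nonneg (Real.rpow_nonneg hG _)]
    exact div_le_of_le_mul₀ (Real.rpow_nonneg hG _) (by positivity) h
  calc _ ≤ ((∑ k ∈ A, |z k| ^ p) ^ (1 / p)) ^ p :=
        Real.rpow_le_rpow (abs_nonneg _) hle hp0.le
    _ = _ := by rw [one_div, Real.rpow_inv_rpow (by positivity) hp0.ne']

theorem sum_rpow_le_blockFunctional_add {p : ℝ} (hp : 1 < p) (A : Finset ι) {g : ι → ℝ}
    (hg : ∀ k, 0 ≤ g k) (z : ι → ℝ) {α δ : ℝ} (hδ : 0 ≤ δ)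
    (hl : ∀ k ∈ A, α * g k ≤ z k) (hr : ∀ k ∈ A, z k ≤ (α + δ) * g k) :
    ∑ k ∈ A, |z k| ^ p ≤
      (|blockFunctional p A g z| + δ * (∑ k ∈ A, g k ^ p) ^ (1 / p)) ^ p := by
  have hp0 : 0 < p := by linarith
  set G := ∑ k ∈ A, g k ^ p with hGdef
  have hG : 0 ≤ G := Finset.sum_nonneg fun k _ => Real.rpow_nonneg (hg k) _
  set t := G ^ (1 / p) with ht
  have ht0 : 0 ≤ t := Real.rpow_nonneg hG _
  have htp : t ^ p = G := by rw [ht, one_div, Real.rpow_inv_rpow hG hp0.ne']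
  have htG : G / G ^ (1 - 1 / p) = t := by
    rcases hG.eq_or_lt with h0 | hpos
    · rw [ht, ← h0, zero_div, Real.zero_rpow (by positivity)]
    · rw [div_eq_iff (by positivity), ht, ← Real.rpow_add hpos]
      simp
  have hgp : ∀ k, g k ^ p = g k * g k ^ (p - 1) := fun k => by
    nth_rewrite 2 [← Real.rpow_one (g k)]
    rw [← Real.rpow_add_of_nonneg (hg k) zero_le_one (by linarith)]
    ring_nf
  have hmul : ∀ β : ℝ, (∑ k ∈ A, β * g k * g k ^ (p - 1)) / G ^ (1 - 1 / p) = β * t :=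
    fun β => by
      rw [← htG, hGdef, ← mul_div_assoc, Finset.mul_sum]
      simp only [hgp, mul_assoc]
  have hL : α * t ≤ blockFunctional p A g z := by
    rw [blockFunctional_apply, ← hmul]
    refine div_le_div_of_nonneg_right (Finset.sum_le_sum fun k hk => ?_)
      (Real.rpow_nonneg hG _)
    exact mul_le_mul_of_nonneg_right (hl k hk) (Real.rpow_nonneg (hg k) _)
  have hR : blockFunctional p A g z ≤ (α + δ) * t := by
    rw [blockFunctional_apply, ← hmul]
    refine div_le_div_of_nonneg_right (Finset.sum_le_sum fun k hk => ?_)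
      (Real.rpow_nonneg hG _)
    exact mul_le_mul_of_nonneg_right (hr k hk) (Real.rpow_nonneg (hg k) _)
  set L := blockFunctional p A g z
  set β := max |α| |α + δ| with hβ
  have hβ0 : 0 ≤ β := (abs_nonneg α).trans (le_max_left _ _)
  have hzβ : ∀ k ∈ A, |z k| ≤ β * g k := fun k hk => by
    have h1 : -α ≤ β := (neg_le_abs α).trans (le_max_left _ _)
    have h2 : α + δ ≤ β := (le_abs_self _).trans (le_max_right _ _)
    exact abs_le.2 ⟨by nlinarith [hl k hk, hg k], by nlinarith [hr k hk, hg k]⟩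
  have hβt : β * t ≤ |L| + δ * t := by
    have h1 := le_abs_self L
    have h2 := neg_abs_le L
    have h3 : 0 ≤ δ * t := by positivity
    rw [hβ, max_mul_of_nonneg _ _ ht0]
    refine max_le ?_ ?_
    · rw [← abs_of_nonneg ht0, ← abs_mul, abs_of_nonneg ht0]
      exact abs_le.2 ⟨by linarith, by linarith⟩
    · rw [← abs_of_nonneg ht0, ← abs_mul, abs_of_nonneg ht0]
      exact abs_le.2 ⟨by linarith, by linarith⟩
  calc ∑ k ∈ A, |z k| ^ p ≤ ∑ k ∈ A, β ^ p * g k ^ p :=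
        Finset.sum_le_sum fun k hk => by
          rw [← Real.mul_rpow hβ0 (hg k)]
          exact Real.rpow_le_rpow (abs_nonneg _) (hzβ k hk) hp0.le
    _ = (β * t) ^ p := by rw [← Finset.mul_sum, Real.mul_rpow hβ0 ht0, htp]
    _ ≤ _ := Real.rpow_le_rpow (by positivity) hβt hp0.le

/-- Finitely many vectors of `ℓ_p^m` are almost preserved by a contraction into `ℓ_p^M`,
where `M` does not depend on `m`. -/
theorem exists_contraction_almost_preserving {p : ℝ} (hp : 1 < p) (n N : ℕ) (hN : 0 < N) :
    ∃ M : ℕ, ∀ (m : ℕ) (f : Fin n → Fin m → ℝ),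
      ∃ W : (Fin m → ℝ) →ₗ[ℝ] (Fin M → ℝ), (∀ z, lpNorm p (W z) ≤ lpNorm p z) ∧
        ∀ i, lpNorm p (f i) ≤ lpNorm p (W (f i)) + (1 / N : ℝ) * ∑ j, lpNorm p (f j) := by
  classical
  have hp0 : 0 < p := by linarith
  have hN' : (0 : ℝ) < N := by exact_mod_cast hN
  let κ := Fin n → Finset.Icc (-N : ℤ) N
  let e : κ ≃ Fin (Fintype.card κ) := Fintype.equivFin κ
  refine ⟨Fintype.card κ, fun m f => ?_⟩
  let g : Fin m → ℝ := ∑ j, fun k => |f j k|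
  have hgk : ∀ k, g k = ∑ j, |f j k| := fun k => by simp [g]
  have hg : ∀ k, 0 ≤ g k := fun k => by rw [hgk]; positivity
  have hfg : ∀ j k, |f j k| ≤ g k := fun j k => by
    rw [hgk]
    exact Finset.single_le_sum (f := fun j => |f j k|) (fun _ _ => abs_nonneg _)
      (Finset.mem_univ j)
  have hfloor : ∀ j k, ⌊N * (f j k / g k)⌋ ∈ Finset.Icc (-N : ℤ) N := fun j k => by
    have h : |f j k / g k| ≤ 1 := by
      rw [abs_div, abs_of_nonneg (hg k)]
      exact div_le_one_of_le₀ (hfg j k) (hg k)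
    obtain ⟨h1, h2⟩ := abs_le.1 h
    rw [Finset.mem_Icc]
    refine ⟨Int.le_floor.2 ?_, ?_⟩
    · push_cast; nlinarith
    · have : (⌊N * (f j k / g k)⌋ : ℝ) ≤ N := (Int.floor_le _).trans (by nlinarith)
      exact_mod_cast this
  let r : Fin m → Fin (Fintype.card κ) := fun k =>
    e fun j => ⟨⌊N * (f j k / g k)⌋, hfloor j k⟩
  let A : Fin (Fintype.card κ) → Finset (Fin m) := fun c => {k | r k = c}
  have hr : ∀ c, ∀ k ∈ A c, ∀ j, ((e.symm c j : ℤ) : ℝ) = ⌊N * (f j k / g k)⌋ := by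
    intro c k hk j
    have hk' : r k = c := by simpa [A] using hk
    simp [← hk', r]
  have hfib : ∀ u : Fin m → ℝ, ∑ c, ∑ k ∈ A c, u k = ∑ k, u k := fun u =>
    Finset.sum_fiberwise _ r u
  refine ⟨LinearMap.pi fun c => blockFunctional p (A c) g, fun z => ?_, fun i => ?_⟩
  · refine Real.rpow_le_rpow (by positivity) ?_ (by positivity)
    rw [← hfib]
    exact Finset.sum_le_sum fun c _ => abs_blockFunctional_rpow_le hp (A c) hg z
  · set W : (Fin m → ℝ) →ₗ[ℝ] _ := LinearMap.pi fun c => blockFunctional p (A c) g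
    let t : Fin (Fintype.card κ) → ℝ := fun c => (∑ k ∈ A c, g k ^ p) ^ (1 / p)
    have ht0 : ∀ c, 0 ≤ t c := fun c =>
      Real.rpow_nonneg (Finset.sum_nonneg fun k _ => Real.rpow_nonneg (hg k) _) _
    have ht : lpNorm p t = lpNorm p g := by
      have : ∀ c, |t c| ^ p = ∑ k ∈ A c, |g k| ^ p := fun c => by
        rw [abs_of_nonneg (ht0 c)]
        simp only [t, abs_of_nonneg (hg _)]
        rw [one_div, Real.rpow_inv_rpow
          (Finset.sum_nonneg fun k _ => Real.rpow_nonneg (hg k) _) hp0.ne']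
      rw [lpNorm, Finset.sum_congr rfl fun c _ => this c, hfib, lpNorm]
    have hgle : lpNorm p g ≤ ∑ j, lpNorm p (f j) :=
      (lpNorm_sum_le hp.le _ _).trans_eq (by simp [lpNorm])
    have hcell : ∀ c, ∑ k ∈ A c, |f i k| ^ p ≤ (|W (f i) c| + 1 / N * t c) ^ p := fun c => by
      have key : ∀ k ∈ A c, ((e.symm c i : ℤ) : ℝ) / N * g k ≤ f i k ∧
          f i k ≤ (((e.symm c i : ℤ) : ℝ) / N + 1 / N) * g k := fun k hk => by
        rw [hr c k hk i]
        rcases (hg k).eq_or_lt with h0 | hpos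
        · have : f i k = 0 := by simpa [← h0] using hfg i k
          simp [this, ← h0]
        · have h1 := Int.floor_le (N * (f i k / g k))
          have h2 := (Int.lt_floor_add_one (N * (f i k / g k))).le
          have h3 : f i k = N * (f i k / g k) / N * g k := by field_simp
          rw [← add_div]
          constructor
          · conv_rhs => rw [h3]
            gcongr
          · conv_lhs => rw [h3]
            gcongr
      exact sum_rpow_le_blockFunctional_add hp (A c) hg (f i) (by positivity)
        (fun k hk => (key k hk).1) (fun k hk => (key k hk).2)
    calc lpNorm p (f i) ≤ (∑ c, |(|W (f i) c| + 1 / N * t c)| ^ p) ^ (1 / p) := by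
          refine Real.rpow_le_rpow (by positivity) ?_ (by positivity)
          rw [← hfib]
          refine Finset.sum_le_sum fun c _ => (hcell c).trans_eq ?_
          rw [abs_of_nonneg (add_nonneg (abs_nonneg _)
            (mul_nonneg (by positivity) (ht0 c)))]
      _ ≤ (∑ c, |(|W (f i) c|)| ^ p) ^ (1 / p) + (∑ c, |1 / N * t c| ^ p) ^ (1 / p) :=
          Real.Lp_add_le _ _ _ hp.le
      _ = lpNorm p (W (f i)) + 1 / N * lpNorm p g := by
          have h := lpNorm_smul hp0 (1 / N : ℝ) t
          rw [ht, abs_of_nonneg (by positivity : (0 : ℝ) ≤ 1 / N)] at h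
          rw [← h]
          simp [lpNorm]
      _ ≤ _ := by gcongr

end Discretization

section LpSpace

variable {Y : Type*} [NormedAddCommGroup Y] [NormedSpace ℝ Y]

theorem IsLpSpaceWith.exists_contraction {p lam : ℝ} (hp : 0 < p) (hY : IsLpSpaceWith p lam Y)
    (E : Submodule ℝ Y) [FiniteDimensional ℝ E] :
    ∃ (m : ℕ) (v : E →ₗ[ℝ] (Fin m → ℝ)), (∀ y, lpNorm p (v y) ≤ ‖y‖) ∧
      ∀ y, ‖y‖ ≤ lam * lpNorm p (v y) := by
  obtain ⟨Y₀, hE, -, v, a, b, ha, hb, hab⟩ := hY E inferInstance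
  by_cases h0 : ∃ y : Y₀, y ≠ 0
  · obtain ⟨y₀, hy₀⟩ := h0
    have hy₀' : 0 < ‖y₀‖ := norm_pos_iff.2 hy₀
    have hb' : ∀ y, ‖y‖ ≤ b * lpNorm p (v y) := fun y => by simpa using hb (v y)
    have hv : 0 < lpNorm p (v y₀) := by
      refine (lpNorm_nonneg p _).lt_of_ne fun h => ?_
      have := hb' y₀
      rw [← h] at this
      linarith
    have ha0 : 0 < a := pos_of_mul_pos_left (hv.trans_le (ha y₀)) hy₀'.le
    have hinv : |a⁻¹| = a⁻¹ := abs_of_pos (inv_pos.2 ha0)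
    refine ⟨_, a⁻¹ • (v.toLinearMap ∘ₗ Submodule.inclusion hE), fun y => ?_, fun y => ?_⟩
    · simp only [LinearMap.smul_apply, LinearMap.comp_apply, LinearEquiv.coe_coe]
      rw [lpNorm_smul hp, hinv, inv_mul_le_iff₀ ha0]
      exact ha (Submodule.inclusion hE y)
    · simp only [LinearMap.smul_apply, LinearMap.comp_apply, LinearEquiv.coe_coe]
      rw [lpNorm_smul hp, hinv]
      calc ‖y‖ ≤ b * lpNorm p (v (Submodule.inclusion hE y)) :=
            hb' (Submodule.inclusion hE y)
        _ = a * b * (a⁻¹ * lpNorm p (v (Submodule.inclusion hE y))) := by field_simp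
        _ ≤ _ := mul_le_mul_of_nonneg_right hab
          (mul_nonneg (inv_pos.2 ha0).le (lpNorm_nonneg p _))
  · push Not at h0
    have hz : ∀ y : E, y = 0 := fun y =>
      Subtype.ext (by simpa using congrArg (fun z : Y₀ => (z : Y)) (h0 (Submodule.inclusion hE y)))
    refine ⟨0, 0, fun y => ?_, fun y => ?_⟩ <;> simp [hz y, lpNorm, hp.ne']

theorem IsLpSpaceWith.exists_uniform_contraction {p lam : ℝ} (hp : 1 < p) (hlam : 0 ≤ lam)
    (hY : IsLpSpaceWith p lam Y) {n : ℕ} (y : Fin n → Y) :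
    ∃ M : ℕ, ∀ (E : Submodule ℝ Y) [FiniteDimensional ℝ E] (hyE : ∀ i, y i ∈ E),
      ∃ V : E →ₗ[ℝ] (Fin M → ℝ), (∀ z, lpNorm p (V z) ≤ ‖z‖) ∧
        ∑ i, ‖y i‖ ≤ 2 * lam * ∑ i, lpNorm p (V ⟨y i, hyE i⟩) := by
  obtain ⟨M, hM⟩ := exists_contraction_almost_preserving hp n (2 * n + 1) (by omega)
  refine ⟨M, fun E _ hyE => ?_⟩
  obtain ⟨m, v, hv, hv'⟩ := hY.exists_contraction (by linarith) E
  obtain ⟨W, hW, hW'⟩ := hM m fun i => v ⟨y i, hyE i⟩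
  refine ⟨W ∘ₗ v, fun z => (hW _).trans (hv z), ?_⟩
  set S := ∑ i, lpNorm p (v ⟨y i, hyE i⟩) with hS
  set R := ∑ i, lpNorm p (W (v ⟨y i, hyE i⟩)) with hR
  have hS0 : 0 ≤ S := Finset.sum_nonneg fun _ _ => lpNorm_nonneg p _
  have h1 : ∑ i, ‖y i‖ ≤ lam * S := by
    rw [hS, Finset.mul_sum]
    exact Finset.sum_le_sum fun i _ => hv' ⟨y i, hyE i⟩
  have h2 : S ≤ R + n * (1 / (2 * n + 1) * S) := by
    have := Finset.sum_le_sum fun i (_ : i ∈ Finset.univ) => hW' i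
    rw [Finset.sum_add_distrib] at this
    simpa using this
  have h3 : (n : ℝ) * (1 / (2 * n + 1) * S) ≤ 1 / 2 * S := by
    rw [← mul_assoc]
    refine mul_le_mul_of_nonneg_right ?_ hS0
    rw [mul_one_div, div_le_div_iff₀ (by positivity) (by positivity)]
    linarith
  have h4 : S ≤ 2 * R := by linarith
  calc _ ≤ lam * S := h1
    _ ≤ lam * (2 * R) := mul_le_mul_of_nonneg_left h4 hlam
    _ = _ := by simp only [hR, LinearMap.comp_apply]; ring

/-- Compactness: contractions on finite-dimensional subspaces with values in a fixed `ℓ_p^M`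
yield a contraction on the whole space. -/
theorem IsLpSpaceWith.exists_global_contraction {p lam : ℝ} (hp : 1 < p) (hlam : 0 ≤ lam)
    (hY : IsLpSpaceWith p lam Y) {n : ℕ} (y : Fin n → Y) :
    ∃ (M : ℕ) (V : Y →ₗ[ℝ] (Fin M → ℝ)), (∀ z, lpNorm p (V z) ≤ ‖z‖) ∧
      ∑ i, ‖y i‖ ≤ 2 * lam * ∑ i, lpNorm p (V (y i)) := by
  classical
  have hp0 : 0 < p := by linarith
  obtain ⟨M, hM⟩ := hY.exists_uniform_contraction hp hlam y
  refine ⟨M, ?_⟩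
  let E : Finset Y → Submodule ℝ Y := fun S => Submodule.span ℝ (↑S ∪ Set.range y)
  have hfin : ∀ S, FiniteDimensional ℝ (E S) := fun S =>
    FiniteDimensional.span_of_finite ℝ (S.finite_toSet.union (Set.finite_range y))
  have hyE : ∀ S i, y i ∈ E S := fun S i =>
    Submodule.subset_span (Or.inr (Set.mem_range_self i))
  choose V hV hV' using fun S => hM (E S) (hyE S)
  let G : Finset Y → Y → Fin M → ℝ := fun S z => if h : z ∈ E S then V S ⟨z, h⟩ else 0
  have hG : ∀ S z (h : z ∈ E S), G S z = V S ⟨z, h⟩ := fun S z h => dif_pos h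
  have hGle : ∀ S z, lpNorm p (G S z) ≤ ‖z‖ := fun S z => by
    by_cases h : z ∈ E S
    · rw [hG S z h]; exact hV S ⟨z, h⟩
    · simp [G, h, lpNorm, hp0.ne']
  let U : Ultrafilter (Finset Y) := Ultrafilter.of Filter.atTop
  have hU : ↑U ≤ (Filter.atTop : Filter (Finset Y)) := Ultrafilter.of_le _
  have hmem : ∀ z, ∀ᶠ S in (U : Filter (Finset Y)), z ∈ E S := fun z =>
    Filter.Eventually.filter_mono hU ((Filter.eventually_ge_atTop {z}).mono fun S hS =>
      Submodule.subset_span (Or.inl (Finset.singleton_subset_iff.1 hS)))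
  have hK : IsCompact (Set.univ.pi fun z : Y => Set.univ.pi fun _ : Fin M =>
      Set.Icc (-‖z‖) ‖z‖) :=
    isCompact_univ_pi fun z => isCompact_univ_pi fun _ => isCompact_Icc
  obtain ⟨L, -, hL⟩ := hK.ultrafilter_le_nhds (U.map G) (by
    rw [Filter.le_principal_iff]
    refine Filter.mem_map.2 (Filter.univ_mem' fun S z _ k _ => ?_)
    exact abs_le.1 ((abs_apply_le_lpNorm hp0 _ k).trans (hGle S z)))
  have hlim : ∀ z, Filter.Tendsto (fun S => G S z) U (nhds (L z)) :=
    tendsto_pi_nhds.1 (show Filter.Tendsto G U (nhds L) from hL)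
  have hadd : ∀ z z', L (z + z') = L z + L z' := fun z z' => by
    refine tendsto_nhds_unique_of_eventuallyEq (hlim (z + z')) ((hlim z).add (hlim z')) ?_
    filter_upwards [hmem z, hmem z'] with S h h'
    rw [hG S _ h, hG S _ h', hG S _ (add_mem h h'), ← map_add]
    rfl
  have hsmul : ∀ (c : ℝ) z, L (c • z) = c • L z := fun c z => by
    refine tendsto_nhds_unique_of_eventuallyEq (hlim (c • z)) ((hlim z).const_smul c) ?_
    filter_upwards [hmem z] with S h
    rw [hG S _ h, hG S _ (Submodule.smul_mem _ c h), ← map_smul]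
    rfl
  have hlimLp : ∀ z, Filter.Tendsto (fun S => lpNorm p (G S z)) U (nhds (lpNorm p (L z))) :=
    fun z => ((continuous_lpNorm hp0 M).tendsto _).comp (hlim z)
  refine ⟨{ toFun := L, map_add' := hadd, map_smul' := hsmul }, fun z => ?_, ?_⟩
  · exact le_of_tendsto (hlimLp z) (Filter.Eventually.of_forall fun S => hGle S z)
  · refine ge_of_tendsto ((tendsto_finsetSum _ fun i _ => hlimLp (y i)).const_mul (2 * lam))
      (Filter.Eventually.of_forall fun S => ?_)
    have h := hV' S
    simpa only [hG S _ (hyE S _)] using h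

/-- The coordinates of a contraction into `ℓ_p^M` have weak `ℓ_p` norm at most one. -/
theorem weakNorm_le_one {p : ℝ} (hp : 1 < p) {M : ℕ} (ψ : Fin M → Y →L[ℝ] ℝ)
    (hψ : ∀ z, lpNorm p (fun c => ψ c z) ≤ ‖z‖) : weakNorm p ψ ≤ 1 := by
  have hp0 : 0 < p := by linarith
  refine Real.iSup_le (fun ⟨Φ, hΦ⟩ => ?_) zero_le_one
  let s : Fin M → ℝ := fun c => Φ (ψ c)
  let u : Fin M → ℝ := fun c => SignType.sign (s c) * |s c| ^ (p - 1)
  set A := ∑ c, |s c| ^ p with hA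
  have hA0 : 0 ≤ A := Finset.sum_nonneg fun _ _ => Real.rpow_nonneg (abs_nonneg _) _
  have hu : ∀ c, |u c| = |s c| ^ (p - 1) := fun c => by
    rcases eq_or_ne (s c) 0 with h | h
    · simp [u, h, Real.zero_rpow (by linarith : p - 1 ≠ 0)]
    · rw [abs_mul, abs_of_nonneg (Real.rpow_nonneg (abs_nonneg (s c)) _)]
      rcases h.lt_or_gt with h | h <;> simp [h]
  have hus : ∀ c, u c * s c = |s c| ^ p := fun c => by
    have : |s c| ^ p = |s c| ^ (p - 1) * |s c| := by
      nth_rewrite 3 [← Real.rpow_one |s c|]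
      rw [← Real.rpow_add_of_nonneg (abs_nonneg _) (by linarith) zero_le_one]
      ring_nf
    calc u c * s c = |s c| ^ (p - 1) * (SignType.sign (s c) * s c) := by
          simp only [u]; ring
      _ = _ := by rw [sign_mul_self, this]
  have hnorm : ‖∑ c, u c • ψ c‖ ≤ A ^ (1 - 1 / p) := by
    refine ContinuousLinearMap.opNorm_le_bound _ (Real.rpow_nonneg hA0 _) fun z => ?_
    have h := abs_sum_mul_le_of_abs_eq_rpow hp Finset.univ (fun c => ψ c z) u s hu
    calc ‖(∑ c, u c • ψ c) z‖ = |∑ c, ψ c z * u c| := by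
          simp [mul_comm]
      _ ≤ lpNorm p (fun c => ψ c z) * A ^ (1 - 1 / p) := h
      _ ≤ ‖z‖ * A ^ (1 - 1 / p) :=
          mul_le_mul_of_nonneg_right (hψ z) (Real.rpow_nonneg hA0 _)
      _ = _ := mul_comm _ _
  have hAle : A ≤ A ^ (1 - 1 / p) := calc
    A = Φ (∑ c, u c • ψ c) := by
        rw [map_sum, hA]
        exact Finset.sum_congr rfl fun c _ => by rw [← hus, map_smul]; rfl
    _ ≤ ‖Φ (∑ c, u c • ψ c)‖ := Real.le_norm_self _
    _ ≤ 1 * ‖∑ c, u c • ψ c‖ := Φ.le_of_opNorm_le hΦ _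
    _ ≤ _ := by rwa [one_mul]
  refine Real.rpow_le_one hA0 ?_ (by positivity)
  by_contra! hlt
  have : A ^ (1 - 1 / p) < A ^ (1 : ℝ) :=
    Real.rpow_lt_rpow_of_exponent_lt hlt (by linarith [one_div_pos.2 hp0])
  rw [Real.rpow_one] at this
  linarith

end LpSpace

section Lipschitz

theorem abs_sub_le_lipNorm_mul_dist {X : Type*} [MetricSpace X] {g : X → ℝ}
    (hg : ∃ K : ℝ, 0 ≤ K ∧ ∀ x y, |g x - g y| ≤ K * dist x y) (x y : X) :
    |g x - g y| ≤ lipNorm g * dist x y := by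
  rcases (dist_nonneg : 0 ≤ dist x y).eq_or_lt with h0 | hpos
  · have : x = y := dist_eq_zero.1 h0.symm
    simp [this]
  · rw [← div_le_iff₀ hpos]
    exact le_csInf hg fun K hK => (div_le_iff₀ hpos).2 (hK.2 x y)

theorem lipNorm_nonneg {X : Type*} [MetricSpace X] (g : X → ℝ) : 0 ≤ lipNorm g :=
  Real.sInf_nonneg fun _ hK => hK.1

theorem sum_abs_sub_le_lipNorm_mul_iSup {X : Type*} [NormedAddCommGroup X] {g : X → ℝ}
    (hg : ∃ K : ℝ, 0 ≤ K ∧ ∀ x y, |g x - g y| ≤ K * dist x y) (hg0 : g 0 = 0) {n : ℕ}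
    (x q : Fin n → X) :
    ∑ i, |g (x i) - g (q i)| ≤
      lipNorm g * ⨆ φ : {φ : X → ℝ // LipschitzWith 1 φ ∧ φ 0 = 0},
        ∑ i, |φ.1 (x i) - φ.1 (q i)| := by
  have h := abs_sub_le_lipNorm_mul_dist hg
  rcases (lipNorm_nonneg g).eq_or_lt with h0 | hpos
  · rw [← h0, zero_mul]
    refine Finset.sum_nonpos fun i _ => ?_
    simpa [← h0] using h (x i) (q i)
  have hbdd : BddAbove (Set.range fun φ : {φ : X → ℝ // LipschitzWith 1 φ ∧ φ 0 = 0} =>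
      ∑ i, |φ.1 (x i) - φ.1 (q i)|) := by
    refine ⟨∑ i, dist (x i) (q i), ?_⟩
    rintro _ ⟨φ, rfl⟩
    exact Finset.sum_le_sum fun i _ => by
      simpa [Real.dist_eq] using φ.2.1.dist_le_mul (x i) (q i)
  have hφ : LipschitzWith 1 (fun x => (lipNorm g)⁻¹ * g x) := by
    refine LipschitzWith.of_dist_le_mul fun a b => ?_
    rw [Real.dist_eq, ← mul_sub, abs_mul, abs_of_pos (inv_pos.2 hpos), NNReal.coe_one,
      one_mul, inv_mul_le_iff₀ hpos]
    exact h a b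
  have hle := le_ciSup hbdd ⟨_, hφ, by simp [hg0]⟩
  simp only [← mul_sub, abs_mul, abs_of_pos (inv_pos.2 hpos), ← Finset.mul_sum] at hle
  rwa [inv_mul_le_iff₀ hpos] at hle

end Lipschitz

/-- Let `X` be a real normed vector space, `2 ≤ p < ∞`, `Y` a real Banach `L_p`-space,
`T : X → Y` Lipschitz, `w ∈ X`, and `T_w(x) = T(w + x) − T(w)`. If the restriction of the
Lipschitz adjoint of `T_w` to `Y*`, `ψ ↦ ψ ∘ T_w : Y* → X^#`, is almost `p`-summing, then `T`
is Lipschitz `1`-summing at the point `w`: there is `C ≥ 0` with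
`∑ ‖T(w + xᵢ) − T(w + qᵢ)‖ ≤ C ⬝ sup_{φ ∈ B_{X^#}} ∑ |φ(xᵢ) − φ(qᵢ)|`. -/
theorem lipschitz_one_summing_at_point {X Y : Type*}
    [NormedAddCommGroup X] [NormedSpace ℝ X]
    [NormedAddCommGroup Y] [NormedSpace ℝ Y] [CompleteSpace Y]
    (p : ℝ) (hp : 2 ≤ p) (hY : ∃ lam : ℝ, 1 < lam ∧ IsLpSpaceWith p lam Y)
    (T : X → Y) (hT : ∃ K : ℝ≥0, LipschitzWith K T) (w : X)
    (hadj : AlmostSummingIntoLip p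
      (fun ψ : Y →L[ℝ] ℝ => fun x => ψ (T (w + x) - T w))) :
    ∃ C : ℝ, 0 ≤ C ∧ ∀ (n : ℕ) (x q : Fin n → X),
      ∑ i, ‖T (w + x i) - T (w + q i)‖ ≤
        C * ⨆ φ : {φ : X → ℝ // LipschitzWith 1 φ ∧ φ 0 = 0},
          ∑ i, |φ.1 (x i) - φ.1 (q i)| := by
  obtain ⟨lam, hlam, hY⟩ := hY
  obtain ⟨K, hK⟩ := hT
  obtain ⟨C, hC, hadj⟩ := hadj
  have hp1 : 1 < p := by linarith
  refine ⟨18 / 5 * lam * C, by positivity, fun n x q => ?_⟩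
  set S := ⨆ φ : {φ : X → ℝ // LipschitzWith 1 φ ∧ φ 0 = 0},
    ∑ i, |φ.1 (x i) - φ.1 (q i)| with hS
  have hS0 : 0 ≤ S := Real.iSup_nonneg fun φ => Finset.sum_nonneg fun _ _ => abs_nonneg _
  let y : Fin n → Y := fun i => T (w + x i) - T (w + q i)
  obtain ⟨M, V, hV, hVy⟩ := hY.exists_global_contraction hp1 (by linarith) y
  let ψ : Fin M → Y →L[ℝ] ℝ := fun c =>
    (LinearMap.proj c ∘ₗ V).mkContinuous 1 fun z => by
      rw [one_mul]
      exact (abs_apply_le_lpNorm (by linarith) (V z) c).trans (hV z)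
  have hψV : ∀ c z, ψ c z = V z c := fun _ _ => rfl
  have hψ : weakNorm p ψ ≤ 1 := weakNorm_le_one hp1 ψ hV
  let F : (Fin M → Bool) → X → ℝ := fun ε z =>
    ∑ c, (if ε c then (1 : ℝ) else -1) * ψ c (T (w + z) - T w)
  have hFsub : ∀ ε a b, F ε a - F ε b =
      rademacherSum (fun c => ψ c (T (w + a) - T (w + b))) ε := fun ε a b => by
    simp only [F, rademacherSum, ← Finset.sum_sub_distrib, ← mul_sub, ← map_sub,
      sub_sub_sub_cancel_right]
  have hF0 : ∀ ε, F ε 0 = 0 := fun ε => by simp [F]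
  have hFlip : ∀ ε, ∃ L : ℝ, 0 ≤ L ∧ ∀ a b, |F ε a - F ε b| ≤ L * dist a b := fun ε => by
    refine ⟨M * K, by positivity, fun a b => ?_⟩
    rw [hFsub]
    calc _ ≤ ∑ c, |(if ε c then (1 : ℝ) else -1) * ψ c (T (w + a) - T (w + b))| :=
          Finset.abs_sum_le_sum_abs _ _
      _ ≤ ∑ c : Fin M, K * dist a b := Finset.sum_le_sum fun c _ => by
          have h1 : |(if ε c then (1 : ℝ) else -1)| = 1 := by split_ifs <;> simp
          have h2 := hK.dist_le_mul (w + a) (w + b)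
          rw [dist_add_left, dist_eq_norm (T _)] at h2
          rw [abs_mul, h1, one_mul, hψV]
          exact ((abs_apply_le_lpNorm (by linarith) _ c).trans (hV _)).trans h2
      _ = _ := by simp [mul_assoc]
  have hmean : (2 ^ M : ℝ)⁻¹ * ∑ ε, lipNorm (F ε) ≤ C := by
    have h1 : (2 ^ M : ℝ)⁻¹ * ∑ ε, lipNorm (F ε) ≤
        √((2 ^ M : ℝ)⁻¹ * ∑ ε, lipNorm (F ε) ^ 2) := by
      refine Real.le_sqrt_of_sq_le ?_
      have h := sq_sum_le_card_mul_sum_sq (s := Finset.univ) (f := fun ε => lipNorm (F ε))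
      simp only [Finset.card_univ, Fintype.card_fun, Fintype.card_bool, Fintype.card_fin,
        Nat.cast_pow, Nat.cast_ofNat] at h
      calc _ = ((2 ^ M : ℝ)⁻¹) ^ 2 * (∑ ε, lipNorm (F ε)) ^ 2 := by ring
        _ ≤ ((2 ^ M : ℝ)⁻¹) ^ 2 * (2 ^ M * ∑ ε, lipNorm (F ε) ^ 2) := by gcongr
        _ = _ := by field_simp
    exact (h1.trans (hadj M ψ)).trans (mul_le_of_le_one_right hC hψ)
  have hKhinchine : ∀ i, lpNorm p (V (y i)) ≤
      9 / 5 * ((2 ^ M : ℝ)⁻¹ * ∑ ε, |F ε (x i) - F ε (q i)|) := fun i => by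
    simp only [hFsub]
    exact (lpNorm_le_sqrt_sum_sq hp _).trans (sqrt_sum_sq_le_rademacher _)
  calc ∑ i, ‖y i‖ ≤ 2 * lam * ∑ i, lpNorm p (V (y i)) := hVy
    _ ≤ 2 * lam * ∑ i, 9 / 5 * ((2 ^ M : ℝ)⁻¹ * ∑ ε, |F ε (x i) - F ε (q i)|) := by
        gcongr with i
        exact hKhinchine i
    _ = 18 / 5 * lam * ((2 ^ M : ℝ)⁻¹ * ∑ ε, ∑ i, |F ε (x i) - F ε (q i)|) := by
        rw [← Finset.mul_sum, ← Finset.mul_sum, Finset.sum_comm]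
        ring
    _ ≤ 18 / 5 * lam * ((2 ^ M : ℝ)⁻¹ * ∑ ε, lipNorm (F ε) * S) := by
        gcongr with ε
        exact sum_abs_sub_le_lipNorm_mul_iSup (hFlip ε) (hF0 ε) x q
    _ = 18 / 5 * lam * ((2 ^ M : ℝ)⁻¹ * ∑ ε, lipNorm (F ε)) * S := by
        rw [← Finset.sum_mul]
        ring
    _ ≤ 18 / 5 * lam * C * S := by gcongr
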